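/- Let h(t) = 0 for t ≤ 0 and h(t) = exp(-1/t) for t > 0, and define f : ℝ → ℝ by f(t) = Σ_{p∈ℤ} h(t+p)·h(-t-p+1). Then f is well-defined (the sum is locally finite), smooth, nonnegative, 1-periodic, vanishes exactly on ℤ, and is flat (all derivatives vanish) at every integer. Consequently, the function b(t) = h(|t|)·f(log|t|) (extended by b(0)=0) is smooth on ℝ, even, flat at 0, and vanishes together with all derivatives at each point t with |t| = e^{-n}, n ∈ ℕ. -/

import Mathlib

open Filter Topology Polynomial Function Set

/-- A smooth function on `ℝ` that vanishes on an open set is flat at every point of the closure. -/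
theorem iteratedDeriv_eq_zero_of_mem_closure {g : ℝ → ℝ} (hg : ContDiff ℝ (⊤ : ℕ∞) g)
    {s : Set ℝ} (hs : IsOpen s) (hgs : ∀ t ∈ s, g t = 0) (k : ℕ) {a : ℝ} (ha : a ∈ closure s) :
    iteratedDeriv k g a = 0 := by
  have hcont : Continuous (iteratedDeriv k g) :=
    hg.continuous_iteratedDeriv k (by exact_mod_cast le_top)
  have hsub : s ⊆ {t | iteratedDeriv k g t = 0} := fun t ht ↦ by
    have hev : g =ᶠ[𝓝 t] fun _ ↦ (0 : ℝ) := by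
      filter_upwards [hs.mem_nhds ht] with y hy using hgs y hy
    simpa using hev.iteratedDeriv_eq k
  exact closure_minimal hsub (isClosed_eq hcont continuous_const) ha

theorem Function.Periodic.deriv {F : ℝ → ℝ} {c : ℝ} (hF : Periodic F c) :
    Periodic (deriv F) c := fun t ↦ by
  rw [← deriv_comp_add_const, funext hF]

theorem Function.Periodic.iteratedDeriv {F : ℝ → ℝ} {c : ℝ} (hF : Periodic F c) (k : ℕ) :
    Periodic (iteratedDeriv k F) c := by
  induction k with
  | zero => simpa using hF
  | succ k ih => simpa [iteratedDeriv_succ] using ih.deriv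

/-- The product of a polynomial in `t⁻¹`, the flat function `exp (-1 / t)` (extended by zero to
`t ≤ 0`) and a function of `log t`. -/
noncomputable def flatLogMul (p : ℝ[X]) (F : ℝ → ℝ) (t : ℝ) : ℝ :=
  p.eval t⁻¹ * expNegInvGlue t * F (Real.log t)

theorem flatLogMul_of_nonpos (p : ℝ[X]) (F : ℝ → ℝ) {t : ℝ} (ht : t ≤ 0) :
    flatLogMul p F t = 0 := by
  simp [flatLogMul, expNegInvGlue.zero_of_nonpos ht]

theorem hasDerivAt_flatLogMul (p : ℝ[X]) {F : ℝ → ℝ} (hF : Differentiable ℝ F)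
    (hb : Bornology.IsBounded (range F)) (t : ℝ) :
    HasDerivAt (flatLogMul p F)
      (flatLogMul (X ^ 2 * (p - derivative p)) F t + flatLogMul (p * X) (deriv F) t) t := by
  rcases eq_or_ne t 0 with rfl | ht
  · rw [flatLogMul_of_nonpos _ _ le_rfl, flatLogMul_of_nonpos _ _ le_rfl, add_zero,
      hasDerivAt_iff_tendsto_slope]
    obtain ⟨C, hC⟩ := hb.exists_norm_le
    have hlim : Tendsto (fun x ↦ ((p * X).eval x⁻¹ * expNegInvGlue x) * F (Real.log x))
        (𝓝[≠] 0) (𝓝 0) := by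
      refine Tendsto.zero_mul_isBoundedUnder_le
        ((expNegInvGlue.tendsto_polynomial_inv_mul_zero (p * X)).mono_left inf_le_left) ?_
      exact isBoundedUnder_of ⟨C, fun x ↦ hC _ (mem_range_self _)⟩
    refine hlim.congr fun x ↦ ?_
    simp only [slope_def_field, flatLogMul, expNegInvGlue.zero, eval_mul, eval_X]
    ring
  · convert! (expNegInvGlue.hasDerivAt_polynomial_eval_inv_mul p t).mul
      ((hF (Real.log t)).hasDerivAt.comp t (Real.hasDerivAt_log ht)) using 1
    simp only [flatLogMul, eval_mul, eval_X, comp_apply]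
    ring

theorem deriv_flatLogMul (p : ℝ[X]) {F : ℝ → ℝ} (hF : Differentiable ℝ F)
    (hb : Bornology.IsBounded (range F)) :
    deriv (flatLogMul p F) =
      flatLogMul (X ^ 2 * (p - derivative p)) F + flatLogMul (p * X) (deriv F) :=
  funext fun t ↦ (hasDerivAt_flatLogMul p hF hb t).deriv

theorem contDiff_flatLogMul {n : ℕ∞} (p : ℝ[X]) {F : ℝ → ℝ} {c : ℝ} (hc : c ≠ 0)
    (hF : ContDiff ℝ (⊤ : ℕ∞) F) (hper : Periodic F c) :
    ContDiff ℝ n (flatLogMul p F) := by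
  apply contDiff_all_iff_nat.2 (fun m ↦ ?_) n
  have hdiff {p : ℝ[X]} {F : ℝ → ℝ} (hF : ContDiff ℝ (⊤ : ℕ∞) F) (hper : Periodic F c) :
      Differentiable ℝ (flatLogMul p F) := fun t ↦
    (hasDerivAt_flatLogMul p (hF.differentiable (by simp))
      (hper.isBounded_of_continuous hc hF.continuous) t).differentiableAt
  induction m generalizing p F with
  | zero => exact contDiff_zero.2 (hdiff hF hper).continuous
  | succ m ih =>
    rw [show ((m + 1 : ℕ) : WithTop ℕ∞) = m + 1 from rfl]
    refine contDiff_succ_iff_deriv.2 ⟨hdiff hF hper, by simp, ?_⟩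
    rw [deriv_flatLogMul p (hF.differentiable (by simp))
      (hper.isBounded_of_continuous hc hF.continuous)]
    exact (ih _ hF hper).add (ih _ (contDiff_infty_iff_deriv.1 hF).2 hper.deriv)

theorem iteratedDeriv_flatLogMul_eq_zero (p : ℝ[X]) {F : ℝ → ℝ} {c : ℝ} (hc : c ≠ 0)
    (hF : ContDiff ℝ (⊤ : ℕ∞) F) (hper : Periodic F c) {t : ℝ}
    (ht : ∀ k, iteratedDeriv k F (Real.log t) = 0) (k : ℕ) :
    iteratedDeriv k (flatLogMul p F) t = 0 := by
  induction k generalizing p F with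
  | zero => simp [flatLogMul, show F (Real.log t) = 0 by simpa using ht 0]
  | succ k ih =>
    have hF' := (contDiff_infty_iff_deriv.1 hF).2
    rw [iteratedDeriv_succ', deriv_flatLogMul p (hF.differentiable (by simp))
      (hper.isBounded_of_continuous hc hF.continuous), iteratedDeriv_add
        (contDiff_flatLogMul (n := k) _ hc hF hper).contDiffAt
        (contDiff_flatLogMul (n := k) _ hc hF' hper.deriv).contDiffAt,
      ih _ hF hper ht, ih _ hF' hper.deriv fun j ↦ by rw [← iteratedDeriv_succ']; exact ht _,
      add_zero]

/-- The restriction to `(-1, 1)` of the periodization `∑ p : ℤ, h (t + p) * h (1 - t - p)`. -/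
noncomputable def bumpPair (t : ℝ) : ℝ :=
  expNegInvGlue t * expNegInvGlue (1 - t) + expNegInvGlue (-t) * expNegInvGlue (1 + t)

theorem contDiff_bumpPair : ContDiff ℝ (⊤ : ℕ∞) bumpPair := by
  unfold bumpPair
  have := expNegInvGlue.contDiff (n := ⊤)
  fun_prop

theorem iteratedDeriv_bumpPair_zero (k : ℕ) : iteratedDeriv k bumpPair 0 = 0 := by
  have hglue := expNegInvGlue.contDiff (n := ⊤)
  have hl : ContDiff ℝ (⊤ : ℕ∞) fun t ↦ expNegInvGlue t * expNegInvGlue (1 - t) := by fun_prop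
  have hr : ContDiff ℝ (⊤ : ℕ∞) fun t ↦ expNegInvGlue (-t) * expNegInvGlue (1 + t) := by fun_prop
  have hk : (k : WithTop ℕ∞) ≤ ((⊤ : ℕ∞) : WithTop ℕ∞) := by exact_mod_cast le_top
  unfold bumpPair
  rw [iteratedDeriv_fun_add (hl.of_le hk).contDiffAt (hr.of_le hk).contDiffAt,
    iteratedDeriv_eq_zero_of_mem_closure hl isOpen_Iio (a := 0) (s := Iio 0) _ k (by simp),
    iteratedDeriv_eq_zero_of_mem_closure hr isOpen_Ioi (a := 0) (s := Ioi 0) _ k (by simp),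
    add_zero]
  · intro t ht
    rw [expNegInvGlue.zero_of_nonpos (neg_nonpos.2 (le_of_lt ht)), zero_mul]
  · intro t ht
    rw [expNegInvGlue.zero_of_nonpos (le_of_lt ht), zero_mul]

theorem bumpPair_nonneg (t : ℝ) : 0 ≤ bumpPair t :=
  add_nonneg (mul_nonneg (expNegInvGlue.nonneg _) (expNegInvGlue.nonneg _))
    (mul_nonneg (expNegInvGlue.nonneg _) (expNegInvGlue.nonneg _))

theorem bumpPair_pos {t : ℝ} (h0 : 0 < t) (h1 : t < 1) : 0 < bumpPair t :=
  add_pos_of_pos_of_nonneg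
    (mul_pos (expNegInvGlue.pos_of_pos h0) (expNegInvGlue.pos_of_pos (sub_pos.2 h1)))
    (mul_nonneg (expNegInvGlue.nonneg _) (expNegInvGlue.nonneg _))

/-- The `p`-th term of the periodization is supported where `-p < t < 1 - p`. -/
theorem lt_and_lt_of_glue_mul_ne_zero {t : ℝ} {p : ℤ}
    (hp : expNegInvGlue (t + p) * expNegInvGlue (-t - p + 1) ≠ 0) : -t < p ∧ p < 1 - t := by
  simp only [ne_eq, mul_eq_zero, expNegInvGlue.zero_iff_nonpos, not_or, not_le] at hp
  constructor <;> linarith [hp.1, hp.2]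

theorem tsum_glue_mul_eq_bumpPair {t : ℝ} (ht : t ∈ Ioo (-1 : ℝ) 1) :
    ∑' p : ℤ, expNegInvGlue (t + p) * expNegInvGlue (-t - p + 1) = bumpPair t := by
  rw [tsum_eq_sum (s := {0, 1})]
  · rw [Finset.sum_pair (by norm_num), bumpPair]
    push_cast
    ring_nf
  · intro p hp
    by_contra hne
    obtain ⟨h1, h2⟩ := lt_and_lt_of_glue_mul_ne_zero hne
    have h3 : (-1 : ℝ) < p := by linarith [ht.2]
    have h4 : (p : ℝ) < 2 := by linarith [ht.1]
    norm_cast at h3 h4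
    simp only [Finset.mem_insert, Finset.mem_singleton] at hp
    lia

theorem periodic_tsum_glue_mul :
    Periodic (fun t : ℝ ↦ ∑' p : ℤ, expNegInvGlue (t + p) * expNegInvGlue (-t - p + 1)) 1 := by
  intro t
  beta_reduce
  rw [← (Equiv.addRight (1 : ℤ)).tsum_eq
    fun p : ℤ ↦ expNegInvGlue (t + p) * expNegInvGlue (-t - p + 1)]
  refine tsum_congr fun p ↦ ?_
  simp only [Equiv.coe_addRight, Int.cast_add, Int.cast_one]
  ring_nf

/-- the sum `f(t) = Σ_{p∈ℤ} h(t+p)h(-t-p+1)` is locally finite, smooth,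
nonnegative, 1-periodic, vanishes exactly on `ℤ` and is flat at every integer; hence
`b(t) = h(|t|)·f(log|t|)` is smooth, even, flat at `0`, and flat at every `|t| = e^{-n}`. -/
theorem stmt_15 (h : ℝ → ℝ) (h0 : ∀ t ≤ 0, h t = 0)
    (h1 : ∀ t > 0, h t = Real.exp (-1 / t))
    (f : ℝ → ℝ) (hf : ∀ t, f t = ∑' p : ℤ, h (t + p) * h (-t - p + 1))
    (b : ℝ → ℝ) (hb : ∀ t ≠ (0 : ℝ), b t = h |t| * f (Real.log |t|)) (hb0 : b 0 = 0) :
    (∀ t : ℝ, {p : ℤ | h (t + p) * h (-t - p + 1) ≠ 0}.Finite) ∧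
    ContDiff ℝ (⊤ : ℕ∞) f ∧ (∀ t, 0 ≤ f t) ∧ Function.Periodic f 1 ∧
    (∀ t : ℝ, f t = 0 ↔ ∃ p : ℤ, t = p) ∧
    (∀ (p : ℤ) (k : ℕ), iteratedDeriv k f p = 0) ∧
    ContDiff ℝ (⊤ : ℕ∞) b ∧ (∀ t, b (-t) = b t) ∧
    (∀ k : ℕ, iteratedDeriv k b 0 = 0) ∧
    (∀ (nn : ℕ) (k : ℕ) (t : ℝ), |t| = Real.exp (-(nn : ℝ)) →
      iteratedDeriv k b t = 0) := by
  obtain rfl : h = expNegInvGlue := by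
    funext t
    rcases le_or_gt t 0 with ht | ht
    · rw [h0 t ht, expNegInvGlue.zero_of_nonpos ht]
    · rw [h1 t ht, expNegInvGlue, if_neg ht.not_ge, neg_div, one_div]
  have hper : Periodic f 1 := by
    rw [funext hf]
    exact periodic_tsum_glue_mul
  have hloc {t : ℝ} (ht : t ∈ Ioo (-1 : ℝ) 1) : f t = bumpPair t := by
    rw [hf, tsum_glue_mul_eq_bumpPair ht]
  have hfract (t : ℝ) : f t = bumpPair (Int.fract t) := by
    rw [← hloc ⟨by linarith [Int.fract_nonneg t], Int.fract_lt_one t⟩, Int.fract]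
    simpa using (hper.sub_int_mul_eq ⌊t⌋ (x := t)).symm
  have hev {t : ℝ} (ht : t ∈ Ioo (-1 : ℝ) 1) : f =ᶠ[𝓝 t] bumpPair := by
    filter_upwards [Ioo_mem_nhds ht.1 ht.2] with s hs using hloc hs
  have hsmooth : ContDiff ℝ (⊤ : ℕ∞) f := by
    refine contDiff_iff_contDiffAt.2 fun t ↦ ?_
    have hshift : f = f ∘ fun s ↦ s - (⌊t⌋ : ℝ) := by
      funext s
      simpa using (hper.sub_int_mul_eq ⌊t⌋ (x := s)).symm
    rw [hshift]
    refine ContDiffAt.comp t ?_ (by fun_prop)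
    exact contDiff_bumpPair.contDiffAt.congr_of_eventuallyEq
      (hev ⟨by linarith [Int.fract_nonneg t, Int.self_sub_floor t],
        by linarith [Int.fract_lt_one t, Int.self_sub_floor t]⟩)
  have hflat (p : ℤ) (k : ℕ) : iteratedDeriv k f p = 0 := by
    have hp : iteratedDeriv k f p = iteratedDeriv k f 0 := by
      simpa using (hper.iteratedDeriv k).int_mul_eq p
    rw [hp, (hev (by norm_num)).iteratedDeriv_eq, iteratedDeriv_bumpPair_zero]
  have hb_eq : b = fun t ↦ flatLogMul 1 f t + flatLogMul 1 f (-t) := by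
    funext t
    rcases lt_trichotomy t 0 with ht | rfl | ht
    · rw [hb t ht.ne, flatLogMul_of_nonpos _ _ ht.le, abs_of_neg ht]
      simp [flatLogMul]
    · simp [hb0, flatLogMul_of_nonpos]
    · rw [hb t ht.ne', flatLogMul_of_nonpos 1 f (t := -t) (by linarith), abs_of_pos ht]
      simp [flatLogMul]
  have hg : ContDiff ℝ (⊤ : ℕ∞) (flatLogMul 1 f) := contDiff_flatLogMul 1 one_ne_zero hsmooth hper
  have hg' : ContDiff ℝ (⊤ : ℕ∞) fun t ↦ flatLogMul 1 f (-t) := hg.comp contDiff_neg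
  have hb_flat {t : ℝ} {p : ℤ} (ht : Real.log t = p) (k : ℕ) : iteratedDeriv k b t = 0 := by
    have hk : (k : WithTop ℕ∞) ≤ ((⊤ : ℕ∞) : WithTop ℕ∞) := by exact_mod_cast le_top
    have hlog : ∀ j, iteratedDeriv j f (Real.log t) = 0 := fun j ↦ ht ▸ hflat p j
    rw [hb_eq, iteratedDeriv_fun_add (hg.of_le hk).contDiffAt (hg'.of_le hk).contDiffAt,
      iteratedDeriv_comp_neg, iteratedDeriv_flatLogMul_eq_zero 1 one_ne_zero hsmooth hper hlog,
      iteratedDeriv_flatLogMul_eq_zero 1 one_ne_zero hsmooth hper (by rwa [Real.log_neg_eq_log])]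
    simp
  -- Flatness of `b` at `0` is covered by `hb_flat` since `Real.log 0 = 0` is an integer.
  refine ⟨fun t ↦ ?_, hsmooth, fun t ↦ hfract t ▸ bumpPair_nonneg _, hper, fun t ↦ ?_, hflat,
    hb_eq ▸ hg.add hg', fun t ↦ ?_, hb_flat (p := 0) (by simp), fun n k t ht ↦ ?_⟩
  · refine (Set.finite_Icc ⌊-t⌋ ⌈1 - t⌉).subset fun p hp ↦ ?_
    obtain ⟨hl, hr⟩ := lt_and_lt_of_glue_mul_ne_zero hp
    exact ⟨Int.cast_le.1 ((Int.floor_le _).trans hl.le), Int.cast_le.1 (hr.le.trans (Int.le_ceil _))⟩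
  · constructor
    · intro ht
      refine ⟨⌊t⌋, ?_⟩
      by_contra hne
      have hpos : 0 < Int.fract t :=
        (Int.fract_nonneg t).lt_of_ne fun h ↦ hne (sub_eq_zero.1 h.symm)
      exact (bumpPair_pos hpos (Int.fract_lt_one t)).ne' (hfract t ▸ ht)
    · rintro ⟨p, rfl⟩
      simpa using hflat p 0
  · simp [hb_eq, add_comm]
  · refine hb_flat (p := -n) ?_ k
    rw [← Real.log_abs, ht, Real.log_exp]
    simp
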